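/- arXiv:2402.14100 — 2 statements merged into one kernel-verified Lean document; each statement's English description precedes it below -/
import Mathlib

section
/- Assume E[∫_0^T S_t² dt] < ∞ and E[|S_0|] < ∞, and let φ ∈ A_{Φ_0}. Then the positive part of V^{Φ_0,φ}_T is integrable (so E[V^{Φ_0,φ}_T] is well defined in [−∞,∞)), and if E[V^{Φ_0,φ}_T] > −∞ then E[∫_0^T φ_t² dt] < ∞. -/
open MeasureTheory Set
open scoped ENNReal

/-- The terminal wealth `V^{Φ₀,φ}_T = -Φ₀ S_0 - ∫_0^T φ_t S_t dt - (Λ/2) ∫_0^T φ_t² dt`. -/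
noncomputable def wealth {Ω : Type*} (T Λ Φ₀ : ℝ) (S φ : ℝ → Ω → ℝ) (ω : Ω) : ℝ :=
  -Φ₀ * S 0 ω - (∫ t in Icc (0:ℝ) T, φ t ω * S t ω)
    - (Λ / 2) * ∫ t in Icc (0:ℝ) T, (φ t ω) ^ 2

/-- The admissible set `𝒜_{Φ₀}`: progressively measurable processes `φ` with
`∫_0^T φ_t² dt < ∞` a.s. and `Φ₀ + ∫_0^T φ_t dt = 0` a.s. -/
def isAdmissible {Ω : Type*} {m0 : MeasurableSpace Ω} (T Φ₀ : ℝ)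
    (ℱ : Filtration ℝ m0) (μ : Measure Ω) (φ : ℝ → Ω → ℝ) : Prop :=
  ProgMeasurable ℱ φ ∧
    (∀ᵐ ω ∂μ, IntegrableOn (fun t => (φ t ω) ^ 2) (Icc (0:ℝ) T)) ∧
    (∀ᵐ ω ∂μ, Φ₀ + ∫ t in Icc (0:ℝ) T, φ t ω = 0)

theorem aux_meas {Ω : Type*} {m0 : MeasurableSpace Ω} (T : ℝ) (ℱ : Filtration ℝ m0)
    (S : ℝ → Ω → ℝ) (h : ProgMeasurable ℱ S) :
    Measurable (fun p : Ω × ℝ => S (min p.2 T) p.1) := by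
  have h1 := (h T).measurable
  have h2 : Measurable (fun p : Iic T × Ω => S p.1 p.2) :=
    h1.mono (sup_le_sup le_rfl (MeasurableSpace.comap_mono (ℱ.le T))) le_rfl
  have h3 : Measurable (fun p : Ω × ℝ => ((⟨min p.2 T, mem_Iic.2 (min_le_right _ _)⟩ : Iic T), p.1)) := by
    refine Measurable.prodMk (Measurable.subtype_mk ?_) measurable_fst
    exact measurable_snd.min measurable_const
  exact h2.comp h3

/-- Pointwise bound. -/
theorem aux_bound (T Λ : ℝ) (hΛ : 0 < Λ) (f s : ℝ → ℝ)
    (hf : AEStronglyMeasurable f (volume.restrict (Icc (0:ℝ) T)))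
    (hs : AEStronglyMeasurable s (volume.restrict (Icc (0:ℝ) T)))
    (hf2 : IntegrableOn (fun t => f t ^ 2) (Icc (0:ℝ) T))
    (hs2 : IntegrableOn (fun t => s t ^ 2) (Icc (0:ℝ) T)) :
    -(∫ t in Icc (0:ℝ) T, f t * s t) ≤ (Λ / 4) * (∫ t in Icc (0:ℝ) T, f t ^ 2)
      + (1 / Λ) * ∫ t in Icc (0:ℝ) T, s t ^ 2 := by
  have hfs : IntegrableOn (fun t => f t * s t) (Icc (0:ℝ) T) :=
    ((memLp_two_iff_integrable_sq hf).2 hf2).integrable_mul ((memLp_two_iff_integrable_sq hs).2 hs2)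
  rw [← integral_neg, ← integral_const_mul, ← integral_const_mul, ← integral_add
    (hf2.const_mul _) (hs2.const_mul _)]
  refine integral_mono hfs.neg ((hf2.const_mul _).add (hs2.const_mul _)) fun t => ?_
  have h : Λ / 4 * f t ^ 2 + 1 / Λ * s t ^ 2 - -(f t * s t) = (Λ * f t + 2 * s t) ^ 2 / (4 * Λ) := by
    field_simp
    ring
  have h' : 0 ≤ (Λ * f t + 2 * s t) ^ 2 / (4 * Λ) := by positivity
  show -(f t * s t) ≤ Λ / 4 * f t ^ 2 + 1 / Λ * s t ^ 2
  linarith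

/-- Assume `E[∫_0^T S_t² dt] < ∞` and `E[|S_0|] < ∞`, and let
`φ ∈ 𝒜_{Φ₀}`.  Then the positive part of `V^{Φ₀,φ}_T` is integrable (so that
`E[V^{Φ₀,φ}_T]` is well defined in `[-∞,∞)`), and if `E[V^{Φ₀,φ}_T] > -∞` (i.e. the
negative part is integrable as well) then `E[∫_0^T φ_t² dt] < ∞`. -/
theorem stmt_4
    {Ω : Type*} {m0 : MeasurableSpace Ω} {μ : Measure Ω} [IsProbabilityMeasure μ]
    (T : ℝ) (hT : 0 < T) (Λ : ℝ) (hΛ : 0 < Λ) (Φ₀ : ℝ)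
    (ℱ : Filtration ℝ m0)
    (S : ℝ → Ω → ℝ)
    (hprog : ProgMeasurable ℱ S)
    (hS2 : ∫⁻ ω, (∫⁻ t in Icc (0:ℝ) T, ENNReal.ofReal ((S t ω) ^ 2)) ∂μ < ⊤)
    (hS0 : Integrable (S 0) μ)
    (φ : ℝ → Ω → ℝ)
    (hφ : isAdmissible T Φ₀ ℱ μ φ) :
    Integrable (fun ω => max (wealth T Λ Φ₀ S φ ω) 0) μ ∧
    ((∫⁻ ω, ENNReal.ofReal (-(wealth T Λ Φ₀ S φ ω)) ∂μ < ⊤) →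
      ∫⁻ ω, (∫⁻ t in Icc (0:ℝ) T, ENNReal.ofReal ((φ t ω) ^ 2)) ∂μ < ⊤) := by
  obtain ⟨hφp, hφ2, -⟩ := hφ
  have mS := aux_meas T ℱ S hprog
  have mφ := aux_meas T ℱ φ hφp
  have eqI : ∀ (u : ℝ → Ω → ℝ) (ω : Ω), EqOn (fun t => u (min t T) ω) (fun t => u t ω) (Icc (0:ℝ) T) := by
    intro u ω t ht
    simp [min_eq_left ht.2]
  have sec : ∀ (u : ℝ → Ω → ℝ), Measurable (fun p : Ω × ℝ => u (min p.2 T) p.1) → ∀ ω,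
      AEStronglyMeasurable (fun t => u t ω) (volume.restrict (Icc (0:ℝ) T)) := by
    intro u hu ω
    have h1 : Measurable (fun t => u (min t T) ω) := hu.comp (measurable_const.prodMk measurable_id)
    refine h1.aestronglyMeasurable.congr ?_
    exact (ae_restrict_iff' measurableSet_Icc).2 (ae_of_all _ fun t ht => eqI u ω ht)
  have mI1 : Measurable (fun ω => ∫ t in Icc (0:ℝ) T, φ t ω * S t ω) := by
    have : (fun ω => ∫ t in Icc (0:ℝ) T, φ t ω * S t ω) =
        fun ω => ∫ t in Icc (0:ℝ) T, φ (min t T) ω * S (min t T) ω := by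
      ext ω
      refine setIntegral_congr_fun measurableSet_Icc fun t ht => ?_
      simp [min_eq_left ht.2]
    rw [this]
    exact (mφ.mul mS).stronglyMeasurable.integral_prod_right.measurable
  have mI2 : Measurable (fun ω => ∫ t in Icc (0:ℝ) T, φ t ω ^ 2) := by
    have : (fun ω => ∫ t in Icc (0:ℝ) T, φ t ω ^ 2) =
        fun ω => ∫ t in Icc (0:ℝ) T, φ (min t T) ω ^ 2 := by
      ext ω
      refine setIntegral_congr_fun measurableSet_Icc fun t ht => ?_
      simp [min_eq_left ht.2]
    rw [this]
    exact (mφ.pow_const 2).stronglyMeasurable.integral_prod_right.measurable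
  have mL : Measurable (fun ω => ∫⁻ t in Icc (0:ℝ) T, ENNReal.ofReal (S t ω ^ 2)) := by
    have : (fun ω => ∫⁻ t in Icc (0:ℝ) T, ENNReal.ofReal (S t ω ^ 2)) =
        fun ω => ∫⁻ t in Icc (0:ℝ) T, ENNReal.ofReal (S (min t T) ω ^ 2) := by
      ext ω
      refine setLIntegral_congr_fun measurableSet_Icc fun t ht => ?_
      simp [min_eq_left ht.2]
    rw [this]
    exact (mS.pow_const 2).ennreal_ofReal.lintegral_prod_right'
  have mW : AEStronglyMeasurable (wealth T Λ Φ₀ S φ) μ := by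
    unfold wealth
    exact ((hS0.aestronglyMeasurable.const_mul _).sub mI1.aestronglyMeasurable).sub
      (mI2.aestronglyMeasurable.const_mul _)
  have hfin := ae_lt_top mL hS2.ne
  have hSI : ∀ᵐ ω ∂μ, IntegrableOn (fun t => S t ω ^ 2) (Icc (0:ℝ) T) := by
    filter_upwards [hfin] with ω hω
    refine ⟨(sec S mS ω).pow 2, ?_⟩
    rw [hasFiniteIntegral_iff_ofReal (ae_of_all _ fun t => sq_nonneg _)]
    exact hω
  have hA : Integrable (fun ω => ∫ t in Icc (0:ℝ) T, S t ω ^ 2) μ := by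
    refine (integrable_toReal_of_lintegral_ne_top mL.aemeasurable hS2.ne).congr (ae_of_all _ fun ω => ?_)
    exact (integral_eq_lintegral_of_nonneg_ae (ae_of_all _ fun t => sq_nonneg _)
      ((sec S mS ω).pow 2)).symm
  have hD : Integrable (fun ω => |Φ₀ * S 0 ω| + (1 / Λ) * ∫ t in Icc (0:ℝ) T, S t ω ^ 2) μ :=
    (hS0.const_mul Φ₀).abs.add (hA.const_mul _)
  have key : ∀ᵐ ω ∂μ, wealth T Λ Φ₀ S φ ω + (Λ / 4) * (∫ t in Icc (0:ℝ) T, φ t ω ^ 2) ≤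
      |Φ₀ * S 0 ω| + (1 / Λ) * ∫ t in Icc (0:ℝ) T, S t ω ^ 2 := by
    filter_upwards [hφ2, hSI] with ω h1 h2
    have := aux_bound T Λ hΛ (fun t => φ t ω) (fun t => S t ω) (sec φ mφ ω) (sec S mS ω) h1 h2
    have h3 := neg_abs_le (Φ₀ * S 0 ω)
    unfold wealth
    linarith
  have hpos : ∀ ω, 0 ≤ ∫ t in Icc (0:ℝ) T, φ t ω ^ 2 := fun ω => integral_nonneg fun t => sq_nonneg _
  have hposS : ∀ ω, 0 ≤ ∫ t in Icc (0:ℝ) T, S t ω ^ 2 := fun ω => integral_nonneg fun t => sq_nonneg _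
  refine ⟨?_, fun hneg => ?_⟩
  · refine hD.mono' (mW.sup aestronglyMeasurable_const) ?_
    filter_upwards [key] with ω h
    rw [Real.norm_of_nonneg (le_max_right _ _)]
    have h4 : 0 ≤ (Λ / 4) * (∫ t in Icc (0:ℝ) T, φ t ω ^ 2) := mul_nonneg (by positivity) (hpos ω)
    have h5 : 0 ≤ (1 / Λ) * ∫ t in Icc (0:ℝ) T, S t ω ^ 2 := mul_nonneg (by positivity) (hposS ω)
    exact max_le (by linarith) (by positivity)
  · have hN : Integrable (fun ω => max (-(wealth T Λ Φ₀ S φ ω)) 0) μ := by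
      refine ⟨mW.neg.sup aestronglyMeasurable_const, ?_⟩
      rw [hasFiniteIntegral_iff_ofReal (ae_of_all μ fun ω => (le_max_right _ _ : (0:ℝ) ≤ max (-(wealth T Λ Φ₀ S φ ω)) 0))]
      simpa [ENNReal.ofReal_max] using hneg
    have hfinal := ((hD.add hN).const_mul (4 / Λ)).lintegral_lt_top
    refine lt_of_le_of_lt (lintegral_mono_ae ?_) hfinal
    filter_upwards [key, hφ2] with ω h h1
    rw [← ofReal_integral_eq_lintegral_ofReal h1 (ae_of_all _ fun t => sq_nonneg _)]
    refine ENNReal.ofReal_le_ofReal ?_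
    have h6 := le_max_left (-(wealth T Λ Φ₀ S φ ω)) 0
    simp only [Pi.add_apply]
    rw [div_mul_eq_mul_div, le_div_iff₀ hΛ]
    linarith
end

section
/- For every H ∈ (0,1) and every t > 0, the function s ↦ Z_H(t,s) is square integrable on (0,t) and ∫_0^t Z_H(t,s)² ds = t^{2H}. -/
open MeasureTheory Set
open scoped ENNReal

/-- The normalizing constant `c_H = (2H Γ(3/2-H) / (Γ(H+1/2) Γ(2-2H)))^{1/2}`. -/
noncomputable def cH (H : ℝ) : ℝ :=
  Real.sqrt (2 * H * Real.Gamma (3 / 2 - H) / (Real.Gamma (H + 1 / 2) * Real.Gamma (2 - 2 * H)))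

/-- The Volterra kernel `Z_H(t,s)` of fractional Brownian motion (for `0 < s < t`):
`Z_H(t,s) = c_H ((t/s)^{H-1/2}(t-s)^{H-1/2} - (H-1/2) s^{1/2-H} ∫_s^t u^{H-3/2}(u-s)^{H-1/2} du)`. -/
noncomputable def volterraKernel (H t s : ℝ) : ℝ :=
  cH H * ((t / s) ^ (H - 1 / 2) * (t - s) ^ (H - 1 / 2)
    - (H - 1 / 2) * s ^ (1 / 2 - H) *
        ∫ u in Ioo s t, u ^ (H - 3 / 2) * (u - s) ^ (H - 1 / 2))

open Filter Topology

lemma ftc_nonneg {f f' : ℝ → ℝ} {a b fa fb : ℝ} (hab : a < b)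
    (hd : ∀ x ∈ Ioo a b, HasDerivAt f (f' x) x) (hp : ∀ x ∈ Ioo a b, 0 ≤ f' x)
    (ha : Tendsto f (𝓝[>] a) (𝓝 fa)) (hb : Tendsto f (𝓝[<] b) (𝓝 fb)) :
    IntervalIntegrable f' volume a b ∧ ∫ x in a..b, f' x = fb - fa := by
  have hc : ContinuousOn (extendFrom (Ioo a b) f) (Icc a b) :=
    continuousOn_Icc_extendFrom_Ioo
      (fun x hx => (hd x hx).continuousAt.continuousWithinAt) ha hb
  have hd' : ∀ x ∈ Ioo a b, HasDerivAt (extendFrom (Ioo a b) f) (f' x) x := by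
    intro x hx
    refine (hd x hx).congr_of_eventuallyEq ?_
    filter_upwards [Ioo_mem_nhds hx.1 hx.2] with y hy
    exact extendFrom_extends (fun z hz => (hd z hz).continuousAt.continuousWithinAt) y hy
  have hi : IntervalIntegrable f' volume a b :=
    (intervalIntegrable_iff_integrableOn_Ioc_of_le hab.le).2
      (intervalIntegral.integrableOn_deriv_of_nonneg hc hd' hp)
  exact ⟨hi, intervalIntegral.integral_eq_sub_of_hasDerivAt_of_tendsto hab hd hi ha hb⟩

lemma beta_real {p q : ℝ} (hp : 0 < p) (hq : 0 < q) :
    IntervalIntegrable (fun x : ℝ => x ^ (p - 1) * (1 - x) ^ (q - 1)) volume 0 1 ∧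
    ∫ x in (0:ℝ)..1, x ^ (p - 1) * (1 - x) ^ (q - 1) =
      Real.Gamma p * Real.Gamma q / Real.Gamma (p + q) := by
  have h1 := Complex.betaIntegral_convergent (u := p) (v := q) (by simpa) (by simpa)
  have h2 := ProbabilityTheory.beta_eq_betaIntegralReal p q hp hq
  have e : ∀ x ∈ Ioo (0:ℝ) 1, (x:ℂ) ^ ((p:ℂ) - 1) * (1 - (x:ℂ)) ^ ((q:ℂ) - 1)
      = ((x ^ (p - 1) * (1 - x) ^ (q - 1) : ℝ) : ℂ) := by
    intro x hx
    rw [Complex.ofReal_mul, Complex.ofReal_cpow hx.1.le, Complex.ofReal_cpow (by linarith [hx.2])]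
    push_cast; rfl
  constructor
  · rw [intervalIntegrable_iff_integrableOn_Ioo_of_le zero_le_one] at h1 ⊢
    have := h1.re
    refine IntegrableOn.congr_fun this ?_ measurableSet_Ioo
    intro x hx
    simp only [e x hx]; simp
  · rw [ProbabilityTheory.beta] at h2
    rw [h2, Complex.betaIntegral, intervalIntegral.integral_of_le zero_le_one,
      intervalIntegral.integral_of_le zero_le_one, integral_Ioc_eq_integral_Ioo,
      integral_Ioc_eq_integral_Ioo, setIntegral_congr_fun measurableSet_Ioo e]
    rw [integral_complex_ofReal]; simp

noncomputable def GG (a y : ℝ) : ℝ := ∫ v in (1:ℝ)..y, v ^ (a - 1) * (v - 1) ^ a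

lemma GG_int {a y : ℝ} (ha : -1/2 < a) (hy : 1 ≤ y) :
    IntervalIntegrable (fun v : ℝ => v ^ (a - 1) * (v - 1) ^ a) volume 1 y := by
  have h := (intervalIntegral.intervalIntegrable_rpow' (a := 0) (b := y - 1) (r := a)
    (by linarith)).comp_sub_right 1
  simp only [zero_add, sub_add_cancel] at h
  refine h.continuousOn_mul ?_
  rw [uIcc_of_le hy]
  intro x hx
  exact (Real.continuousAt_rpow_const _ _ (Or.inl (by linarith [hx.1]))).continuousWithinAt

lemma GG_deriv {a y : ℝ} (ha : -1/2 < a) (hy : 1 < y) :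
    HasDerivAt (GG a) (y ^ (a - 1) * (y - 1) ^ a) y := by
  have hc : ContinuousOn (fun v : ℝ => v ^ (a - 1) * (v - 1) ^ a) (Ioi 1) := by
    intro v hv
    have hv : 1 < v := hv
    refine ContinuousAt.continuousWithinAt (ContinuousAt.mul ?_ ?_)
    · exact Real.continuousAt_rpow_const _ _ (Or.inl (by linarith))
    · exact (continuousAt_id.sub continuousAt_const).rpow_const (Or.inl (by simp; linarith))
  exact intervalIntegral.integral_hasDerivAt_right (GG_int ha hy.le)
    (hc.stronglyMeasurableAtFilter isOpen_Ioi y hy) (hc.continuousAt (Ioi_mem_nhds hy))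

lemma GG_nonneg {a y : ℝ} (hy : 1 ≤ y) : 0 ≤ GG a y := by
  refine intervalIntegral.integral_nonneg hy fun v hv => ?_
  have := hv.1
  exact mul_nonneg (Real.rpow_nonneg (by linarith) _) (Real.rpow_nonneg (by linarith) _)

lemma GG_le {a k y : ℝ} (ha : -1/2 < a) (hk0 : 0 ≤ k) (hk1 : k ≤ 1 - a) (hk2 : k < 1 + a)
    (hy : 1 ≤ y) : GG a y ≤ (y - 1) ^ (1 + a - k) / (1 + a - k) := by
  have h := (intervalIntegral.intervalIntegrable_rpow' (a := 0) (b := y - 1) (r := a - k)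
    (by linarith)).comp_sub_right 1
  simp only [zero_add, sub_add_cancel] at h
  calc GG a y ≤ ∫ v in (1:ℝ)..y, (v - 1) ^ (a - k) := by
        refine intervalIntegral.integral_mono_on_of_le_Ioo hy (GG_int ha hy) h fun v hv => ?_
        have h1 : 0 < v - 1 := by linarith [hv.1]
        have h2 : v ^ (a - 1) ≤ (v - 1) ^ (-k) :=
          calc v ^ (a - 1) ≤ v ^ (-k) := Real.rpow_le_rpow_of_exponent_le hv.1.le (by linarith)
            _ ≤ (v - 1) ^ (-k) := Real.rpow_le_rpow_of_nonpos h1 (by linarith) (by linarith)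
        calc v ^ (a - 1) * (v - 1) ^ a ≤ (v - 1) ^ (-k) * (v - 1) ^ a :=
              mul_le_mul_of_nonneg_right h2 (Real.rpow_nonneg h1.le _)
          _ = (v - 1) ^ (a - k) := by rw [← Real.rpow_add h1]; congr 1; ring
    _ = (y - 1) ^ (1 + a - k) / (1 + a - k) := by
        rw [intervalIntegral.integral_comp_sub_right (fun v => v ^ (a - k)) 1,
          integral_rpow (Or.inl (by linarith))]
        have : a - k + 1 = 1 + a - k := by ring
        rw [this, sub_self, Real.zero_rpow (by linarith), sub_zero]

noncomputable def KK (a x : ℝ) : ℝ := x ^ (-a) * (1 - x) ^ a - a * x ^ a * GG a x⁻¹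

lemma kernel_eq {H t s : ℝ} (hs : 0 < s) (hst : s < t) :
    volterraKernel H t s = cH H * t ^ (H - 1/2) * KK (H - 1/2) (s / t) := by
  have ht : 0 < t := hs.trans hst
  set a := H - 1/2 with ha
  have hI : ∫ u in Ioo s t, u ^ (a - 1) * (u - s) ^ a = s ^ a * s ^ a * GG a (t / s) := by
    have h := intervalIntegral.smul_integral_comp_mul_left (a := 1) (b := t / s)
      (fun u : ℝ => u ^ (a - 1) * (u - s) ^ a) s
    rw [mul_one, mul_div_cancel₀ _ hs.ne', intervalIntegral.integral_of_le hst.le,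
      integral_Ioc_eq_integral_Ioo] at h
    rw [← h, GG, smul_eq_mul, ← intervalIntegral.integral_const_mul,
      ← intervalIntegral.integral_const_mul]
    refine intervalIntegral.integral_congr fun v hv => ?_
    rw [uIcc_of_le (by rw [le_div_iff₀ hs]; linarith)] at hv
    have hv1 := hv.1
    have e : s * v - s = s * (v - 1) := by ring
    simp only [e]
    rw [Real.mul_rpow hs.le (by linarith), Real.mul_rpow hs.le (by linarith),
      Real.rpow_sub_one hs.ne']
    field_simp
  have e1 : H - 3/2 = a - 1 := by rw [ha]; ring
  have e2 : 1/2 - H = -a := by rw [ha]; ring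
  rw [volterraKernel, ← ha, e1, e2, hI, KK, inv_div]
  have h1 : 1 - s / t = (t - s) / t := by field_simp
  rw [h1, Real.div_rpow (sub_nonneg.2 hst.le) ht.le, Real.div_rpow ht.le hs.le,
    Real.div_rpow hs.le ht.le, Real.div_rpow hs.le ht.le, Real.rpow_neg hs.le, Real.rpow_neg ht.le]
  have := (Real.rpow_pos_of_pos hs a).ne'
  have := (Real.rpow_pos_of_pos ht a).ne'
  field_simp

noncomputable def FF (a x : ℝ) : ℝ :=
  (a ^ 2 * (x ^ (1 + 2 * a) * GG a x⁻¹ ^ 2) - 2 * a * (GG a x⁻¹ * (1 - (1 - x) ^ (a + 1)))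
    + x ^ (-(2 * a)) * ((1 - x) ^ (a + 1) - (1 - x) ^ (2 * a + 1))) / (1 + 2 * a)

lemma psi_deriv {a x : ℝ} (ha : -1/2 < a) (hx : x ∈ Ioo (0:ℝ) 1) :
    HasDerivAt (fun x => GG a x⁻¹) (-(x ^ (-(2 * a) - 1) * (1 - x) ^ a)) x := by
  have h0 := hx.1
  have h := (GG_deriv (y := x⁻¹) ha (by rw [one_lt_inv₀ h0]; exact hx.2)).comp x
    (hasDerivAt_inv h0.ne')
  convert! h using 1
  have e : x⁻¹ - 1 = (1 - x) / x := by field_simp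
  have e2 : -(2 * a) - 1 = -a + -a + -1 := by ring
  rw [e2, e, Real.div_rpow (by linarith [hx.2]) h0.le, Real.rpow_sub_one (by positivity),
    Real.inv_rpow h0.le, Real.rpow_add h0, Real.rpow_add h0, Real.rpow_neg h0.le,
    Real.rpow_neg_one]
  have := (Real.rpow_pos_of_pos h0 a).ne'
  field_simp

lemma FF_deriv {a x : ℝ} (ha : -1/2 < a) (hx : x ∈ Ioo (0:ℝ) 1) :
    HasDerivAt (FF a)
      (KK a x ^ 2 - (1 - a) / (1 + 2 * a) * (x ^ (-(2 * a)) * (1 - x) ^ a)) x := by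
  have h0 := hx.1
  have h1 : 0 < 1 - x := by linarith [hx.2]
  have hψ := psi_deriv ha hx
  have d1 : ∀ r : ℝ, HasDerivAt (fun x : ℝ => x ^ r) (r * x ^ (r - 1)) x := fun r =>
    Real.hasDerivAt_rpow_const (Or.inl h0.ne')
  have d2 : ∀ r : ℝ, HasDerivAt (fun x : ℝ => (1 - x) ^ r) (-1 * r * (1 - x) ^ (r - 1)) x :=
    fun r => ((hasDerivAt_id x).const_sub 1).rpow_const (Or.inl h1.ne')
  have h := (((((d1 (1 + 2 * a)).mul (hψ.pow 2)).const_mul (a ^ 2)).sub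
    ((hψ.mul ((d2 (a + 1)).const_sub 1)).const_mul (2 * a))).add
    ((d1 (-(2 * a))).mul ((d2 (a + 1)).sub (d2 (2 * a + 1))))).div_const (1 + 2 * a)
  convert! h using 1
  have hne : (1 + 2 * a) ≠ 0 := by linarith
  rw [KK]
  have e1 : 1 + 2 * a - 1 = a + a := by ring
  have e2 : a + 1 - 1 = a := by ring
  have e3 : 2 * a + 1 - 1 = a + a := by ring
  have e4 : 2 * a + 1 = a + a + 1 := by ring
  have e5 : 1 + 2 * a = a + a + 1 := by ring
  have e6 : -(2 * a) = -a + -a := by ring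
  rw [eq_div_iff hne, sub_mul, div_mul_eq_mul_div, div_mul_cancel₀ _ hne, e1, e2, e3]
  simp only [Pi.pow_apply, Pi.sub_apply]
  rw [show x ^ (1 + 2 * a) = x ^ (a + a + 1) by rw [e5],
    show (1 - x) ^ (2 * a + 1) = (1 - x) ^ (a + a + 1) by rw [e4], e6,
    Real.rpow_sub_one h0.ne', Real.rpow_add_one h0.ne', Real.rpow_add_one h1.ne',
    Real.rpow_add_one h1.ne', Real.rpow_add h0, Real.rpow_add h0, Real.rpow_add h1,
    Real.rpow_neg h0.le]
  have := (Real.rpow_pos_of_pos h0 a).ne'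
  generalize GG a x⁻¹ = P
  generalize (1 - x) ^ a = w
  generalize x ^ a = Y at *
  field_simp
  ring

lemma FF_zero {a : ℝ} (ha : -1/2 < a) (ha' : a < 1/2) : Tendsto (FF a) (𝓝[>] 0) (𝓝 0) := by
  obtain ⟨m, hm0, hm1, hb⟩ : ∃ m : ℝ, 0 < m ∧ m < 1/2 + a ∧
      ∀ y, 1 ≤ y → GG a y ≤ (y - 1) ^ m / m := by
    have := abs_lt.2 ⟨by linarith, ha'⟩
    refine ⟨1 + a - (3/4 - |a|/2), ?_, ?_, fun y hy => GG_le ha ?_ ?_ ?_ hy⟩ <;>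
    linarith [neg_abs_le a, le_abs_self a]
  have hev : ∀ᶠ x : ℝ in 𝓝[>] 0, x ∈ Ioo (0:ℝ) 1 := Ioo_mem_nhdsGT one_pos
  have hψ : ∀ x ∈ Ioo (0:ℝ) 1, 0 ≤ GG a x⁻¹ ∧ GG a x⁻¹ ≤ x ^ (-m) / m := by
    intro x hx
    have h1 : 1 ≤ x⁻¹ := (one_le_inv₀ hx.1).2 hx.2.le
    refine ⟨GG_nonneg h1, (hb _ h1).trans ?_⟩
    rw [Real.rpow_neg hx.1.le, ← Real.inv_rpow hx.1.le]
    gcongr <;> linarith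
  have hpow : ∀ r : ℝ, 0 < r → Tendsto (fun x : ℝ => x ^ r) (𝓝[>] 0) (𝓝 0) := by
    intro r hr
    have := (Real.continuousAt_rpow_const 0 r (Or.inr hr.le)).tendsto
    rw [Real.zero_rpow hr.ne'] at this
    exact this.mono_left nhdsWithin_le_nhds
  have hsl : ∀ f : ℝ → ℝ, ∀ f' : ℝ, HasDerivAt f f' 0 → f 0 = 0 →
      Tendsto (fun x => x⁻¹ * f x) (𝓝[>] 0) (𝓝 f') := by
    intro f f' h h0
    simpa [h0] using h.tendsto_slope_zero_right
  have d2 : ∀ r : ℝ, HasDerivAt (fun x : ℝ => (1 - x) ^ r) (-1 * r * (1 - 0) ^ (r - 1)) 0 :=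
    fun r => ((hasDerivAt_id (0:ℝ)).const_sub 1).rpow_const (Or.inl (by simp))
  have T1 : Tendsto (fun x => x ^ (1 + 2 * a) * GG a x⁻¹ ^ 2) (𝓝[>] 0) (𝓝 0) := by
    have h := (hpow (1 + 2 * a - 2 * m) (by linarith)).div_const (m ^ 2)
    rw [zero_div] at h
    refine tendsto_of_tendsto_of_tendsto_of_le_of_le' tendsto_const_nhds h ?_ ?_
    · filter_upwards [hev] with x hx
      have := hx.1
      positivity
    · filter_upwards [hev] with x hx
      have h0 := hx.1
      obtain ⟨h2, h3⟩ := hψ x hx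
      calc x ^ (1 + 2 * a) * GG a x⁻¹ ^ 2 ≤ x ^ (1 + 2 * a) * (x ^ (-m) / m) ^ 2 := by gcongr
        _ = x ^ (1 + 2 * a - 2 * m) / m ^ 2 := by
          rw [show 1 + 2 * a - 2 * m = 1 + 2 * a + -m + -m by ring, Real.rpow_add h0 (1 + 2 * a + -m),
            Real.rpow_add h0 (1 + 2 * a)]
          ring
  have T2' : Tendsto (fun x => x * GG a x⁻¹) (𝓝[>] 0) (𝓝 0) := by
    have h := (hpow (1 - m) (by linarith)).div_const m
    rw [zero_div] at h
    refine tendsto_of_tendsto_of_tendsto_of_le_of_le' tendsto_const_nhds h ?_ ?_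
    · filter_upwards [hev] with x hx
      exact mul_nonneg hx.1.le (hψ x hx).1
    · filter_upwards [hev] with x hx
      have h0 := hx.1
      obtain ⟨h2, h3⟩ := hψ x hx
      calc x * GG a x⁻¹ ≤ x * (x ^ (-m) / m) := by gcongr
        _ = x ^ (1 - m) / m := by
          rw [sub_eq_add_neg, Real.rpow_add h0, Real.rpow_one]
          ring
  have T2 : Tendsto (fun x => GG a x⁻¹ * (1 - (1 - x) ^ (a + 1))) (𝓝[>] 0) (𝓝 0) := by
    have h := T2'.mul (hsl _ _ ((d2 (a + 1)).const_sub 1) (by simp))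
    rw [zero_mul] at h
    refine h.congr' ?_
    filter_upwards [hev] with x hx
    have := hx.1.ne'
    field_simp
  have T3 : Tendsto (fun x : ℝ => x ^ (-(2 * a)) * ((1 - x) ^ (a + 1) - (1 - x) ^ (2 * a + 1)))
      (𝓝[>] 0) (𝓝 0) := by
    have h := (hpow (-(2 * a) + 1) (by linarith)).mul
      (hsl _ _ ((d2 (a + 1)).sub (d2 (2 * a + 1))) (by simp))
    rw [zero_mul] at h
    refine h.congr' ?_
    filter_upwards [hev] with x hx
    have := hx.1.ne'
    rw [Real.rpow_add_one this]
    simp only [Pi.sub_apply]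
    field_simp
  have := (((T1.const_mul (a ^ 2)).sub (T2.const_mul (2 * a))).add T3).div_const (1 + 2 * a)
  simpa [FF] using! this

lemma FF_one {a : ℝ} (ha : -1/2 < a) (ha' : a < 1/2) : Tendsto (FF a) (𝓝[<] 1) (𝓝 0) := by
  obtain ⟨m, hm0, hm1, hb⟩ : ∃ m : ℝ, 0 < m ∧ m < 1/2 + a ∧
      ∀ y, 1 ≤ y → GG a y ≤ (y - 1) ^ m / m := by
    have := abs_lt.2 ⟨by linarith, ha'⟩
    refine ⟨1 + a - (3/4 - |a|/2), ?_, ?_, fun y hy => GG_le ha ?_ ?_ ?_ hy⟩ <;>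
    linarith [neg_abs_le a, le_abs_self a]
  have hev : ∀ᶠ x : ℝ in 𝓝[<] 1, x ∈ Ioo (0:ℝ) 1 := Ioo_mem_nhdsLT one_pos
  have hψ : Tendsto (fun x => GG a x⁻¹) (𝓝[<] 1) (𝓝 0) := by
    have h : Tendsto (fun x : ℝ => (x⁻¹ - 1) ^ m / m) (𝓝[<] 1) (𝓝 0) := by
      have : ContinuousAt (fun x : ℝ => (x⁻¹ - 1) ^ m / m) 1 :=
        (((continuousAt_inv₀ one_ne_zero).sub continuousAt_const).rpow_const
          (Or.inr hm0.le)).div_const m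
      have := this.tendsto
      simp only [inv_one, sub_self, Real.zero_rpow hm0.ne', zero_div] at this
      exact this.mono_left nhdsWithin_le_nhds
    refine tendsto_of_tendsto_of_tendsto_of_le_of_le' tendsto_const_nhds h ?_ ?_
    · filter_upwards [hev] with x hx
      exact GG_nonneg ((one_le_inv₀ hx.1).2 hx.2.le)
    · filter_upwards [hev] with x hx
      exact hb _ ((one_le_inv₀ hx.1).2 hx.2.le)
  have hpow : ∀ r : ℝ, 0 < r → Tendsto (fun x : ℝ => (1 - x) ^ r) (𝓝[<] 1) (𝓝 0) := by
    intro r hr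
    have : ContinuousAt (fun x : ℝ => (1 - x) ^ r) 1 :=
      (continuousAt_const.sub continuousAt_id).rpow_const (Or.inr hr.le)
    have := this.tendsto
    simp only [sub_self, Real.zero_rpow hr.ne'] at this
    exact this.mono_left nhdsWithin_le_nhds
  have hp2 : ∀ r : ℝ, Tendsto (fun x : ℝ => x ^ r) (𝓝[<] 1) (𝓝 1) := by
    intro r
    have := (Real.continuousAt_rpow_const 1 r (Or.inl one_ne_zero)).tendsto
    rw [Real.one_rpow] at this
    exact this.mono_left nhdsWithin_le_nhds
  have h1 := hpow (a + 1) (by linarith)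
  have := (((((hp2 (1 + 2 * a)).mul (hψ.pow 2)).const_mul (a ^ 2)).sub
    ((hψ.mul (h1.const_sub 1)).const_mul (2 * a))).add
    ((hp2 (-(2 * a))).mul (h1.sub (hpow (2 * a + 1) (by linarith))))).div_const (1 + 2 * a)
  simpa [FF] using! this

lemma KK_sq {a : ℝ} (ha : -1/2 < a) (ha' : a < 1/2) :
    IntervalIntegrable (fun x => KK a x ^ 2) volume 0 1 ∧
    ∫ x in (0:ℝ)..1, KK a x ^ 2 = (1 - a) / (1 + 2 * a) *
      (Real.Gamma (1 - 2 * a) * Real.Gamma (a + 1) / Real.Gamma (2 - a)) := by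
  obtain ⟨b1, b2⟩ := beta_real (p := 1 - 2 * a) (q := a + 1) (by linarith) (by linarith)
  rw [show 1 - 2 * a - 1 = -(2 * a) by ring, show a + 1 - 1 = a by ring] at b1 b2
  rw [show 1 - 2 * a + (a + 1) = 2 - a by ring] at b2
  set k : ℝ → ℝ := fun x => x ^ (-(2 * a)) * (1 - x) ^ a with hk
  have hkc : ContinuousOn k (Ioo 0 1) := by
    intro x hx
    refine ContinuousAt.continuousWithinAt (ContinuousAt.mul ?_ ?_)
    · exact Real.continuousAt_rpow_const _ _ (Or.inl hx.1.ne')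
    · exact (continuousAt_const.sub continuousAt_id).rpow_const
        (Or.inl (by have := hx.2; simp; linarith))
  have hP : ContinuousOn (fun x => ∫ y in (0:ℝ)..x, k y) (Icc 0 1) := by
    have := intervalIntegral.continuousOn_primitive_interval'
      b1 (left_mem_uIcc)
    rwa [uIcc_of_le zero_le_one] at this
  have hPd : ∀ x ∈ Ioo (0:ℝ) 1, HasDerivAt (fun x => ∫ y in (0:ℝ)..x, k y) (k x) x := by
    intro x hx
    refine intervalIntegral.integral_hasDerivAt_right (b1.mono_set ?_)
      (hkc.stronglyMeasurableAtFilter isOpen_Ioo x hx) (hkc.continuousAt (Ioo_mem_nhds hx.1 hx.2))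
    rw [uIcc_of_le zero_le_one, uIcc_of_le hx.1.le]
    exact Icc_subset_Icc_right hx.2.le
  have P0 : Tendsto (fun x => ∫ y in (0:ℝ)..x, k y) (𝓝[>] 0) (𝓝 0) := by
    have := (hP 0 (by simp)).tendsto
    rw [intervalIntegral.integral_same] at this
    exact this.mono_left (nhdsWithin_le_of_mem (Icc_mem_nhdsGT one_pos))
  have P1 : Tendsto (fun x => ∫ y in (0:ℝ)..x, k y) (𝓝[<] 1) (𝓝 (∫ y in (0:ℝ)..1, k y)) := by
    have := (hP 1 (by simp)).tendsto
    exact this.mono_left (nhdsWithin_le_of_mem (Icc_mem_nhdsLT one_pos))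
  have := ftc_nonneg (f := fun x => FF a x + (1 - a) / (1 + 2 * a) * ∫ y in (0:ℝ)..x, k y)
    (f' := fun x => KK a x ^ 2) zero_lt_one
    (fun x hx => by
      have := (FF_deriv ha hx).add ((hPd x hx).const_mul ((1 - a) / (1 + 2 * a)))
      rw [hk] at this
      convert! this using 1
      ring)
    (fun x _ => sq_nonneg _)
    ((FF_zero ha ha').add (P0.const_mul _)) ((FF_one ha ha').add (P1.const_mul _))
  refine ⟨this.1, this.2.trans ?_⟩
  rw [b2]; ring

lemma cH_sq {a : ℝ} (ha : -1/2 < a) (ha' : a < 1/2) :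
    cH (a + 1/2) ^ 2 * ((1 - a) / (1 + 2 * a) *
      (Real.Gamma (1 - 2 * a) * Real.Gamma (a + 1) / Real.Gamma (2 - a))) = 1 := by
  have g1 := Real.Gamma_pos_of_pos (show 0 < 1 - 2 * a by linarith)
  have g2 := Real.Gamma_pos_of_pos (show 0 < a + 1 by linarith)
  have g3 := Real.Gamma_pos_of_pos (show 0 < 1 - a by linarith)
  have h1 : 0 < 1 - a := by linarith
  have h2 : 0 < 1 + 2 * a := by linarith
  rw [cH, show 2 - a = (1 - a) + 1 by ring, Real.Gamma_add_one h1.ne',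
    show 3/2 - (a + 1/2) = 1 - a by ring, show a + 1/2 + 1/2 = a + 1 by ring,
    show 2 - 2 * (a + 1/2) = 1 - 2 * a by ring, show 2 * (a + 1/2) = 1 + 2 * a by ring,
    Real.sq_sqrt (by positivity)]
  field_simp

/-- For every `H ∈ (0,1)` and every `t > 0`, the function
`s ↦ Z_H(t,s)` is square integrable on `(0,t)` and `∫_0^t Z_H(t,s)² ds = t^{2H}`. -/
theorem stmt_14 (H : ℝ) (hH : H ∈ Ioo (0:ℝ) 1) (t : ℝ) (ht : 0 < t) :
    IntegrableOn (fun s => (volterraKernel H t s) ^ 2) (Ioo 0 t) volume ∧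
    ∫ s in Ioo (0:ℝ) t, (volterraKernel H t s) ^ 2 = t ^ (2 * H) := by
  obtain ⟨h0, h1⟩ := hH
  have ha : -1/2 < H - 1/2 := by linarith
  have ha' : H - 1/2 < 1/2 := by linarith
  obtain ⟨k1, k2⟩ := KK_sq ha ha'
  have hc := cH_sq ha ha'
  rw [← k2, sub_add_cancel] at hc
  set a := H - 1/2 with hadef
  have e : ∀ s ∈ Ioo 0 t, (cH H * t ^ a) ^ 2 * (KK a (t⁻¹ * s)) ^ 2 = volterraKernel H t s ^ 2 := by
    intro s hs
    rw [kernel_eq hs.1 hs.2, ← hadef, div_eq_inv_mul]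
    ring
  have hi : IntervalIntegrable (fun s => (cH H * t ^ a) ^ 2 * (KK a (t⁻¹ * s)) ^ 2) volume 0 t := by
    have := k1.comp_mul_left (c := t⁻¹)
    simp only [zero_div, one_div, inv_inv] at this
    exact this.const_mul _
  refine ⟨?_, ?_⟩
  · rw [intervalIntegrable_iff_integrableOn_Ioo_of_le ht.le] at hi
    exact hi.congr_fun e measurableSet_Ioo
  · rw [← setIntegral_congr_fun measurableSet_Ioo e, ← integral_Ioc_eq_integral_Ioo,
      ← intervalIntegral.integral_of_le ht.le, intervalIntegral.integral_const_mul,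
      intervalIntegral.integral_comp_mul_left (fun x => KK a x ^ 2) (inv_ne_zero ht.ne'),
      mul_zero, inv_mul_cancel₀ ht.ne', inv_inv, smul_eq_mul]
    have e2 : 2 * H = a + a + 1 := by rw [hadef]; ring
    rw [e2, Real.rpow_add_one ht.ne', Real.rpow_add ht]
    linear_combination (t ^ a * t ^ a * t) * hc
end
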